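/- Consider ρ populations, where population r has n^r strategies, positive revision rates λ_1^r,…,λ_{n^r}^r, normalization constant τ̄^r > 0, and sign-preserving Lipschitz functions φ_1^r,…,φ_{n^r}^r defining an RM-PC protocol, each satisfying n^r = 2 or (n^r ≥ 3 and λ_R^r < λ̄_{φ^r}(n^r)). Let F : 𝕏 → ℝ^n (n = n^1 + ⋯ + n^ρ) be a continuously differentiable game that is weighted contractive for some positive weights w^1,…,w^ρ. Then the Nash equilibria set NE(F) = {x ∈ 𝕏 : xᵀF(x) ≥ yᵀF(x) for all y ∈ 𝕏} is a globally asymptotically stable equilibria set of the mean closed loop ODE ẋ^r(t) = V^r(x^r(t), F^r(x(t))), r = 1,…,ρ: the set NE(F) is Lyapunov stable, and every solution with initial condition x(0) ∈ 𝕏 remains in 𝕏 and converges to NE(F) as t → ∞. -/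

import Mathlib

open scoped BigOperators
open Finset

noncomputable section

namespace RMPC

/-- The probability simplex in `ℝ^n`. -/
def simplex (n : ℕ) : Set (Fin n → ℝ) :=
  {x | (∀ i, 0 ≤ x i) ∧ ∑ i, x i = 1}

/-- A function `φ : ℝ → ℝ` is sign-preserving if it is positive on positive
arguments and vanishes on nonpositive ones (hence takes values in `ℝ_{≥0}`). -/
def SignPreserving (φ : ℝ → ℝ) : Prop :=
  (∀ s : ℝ, 0 < s → 0 < φ s) ∧ (∀ s : ℝ, s ≤ 0 → φ s = 0)

/-- The RM-PC mean dynamics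
`V_i(x,p) = Σ_{j≠i} λ_j (1/τ̄) φ_i(p_i − p_j) x_j − Σ_{j≠i} λ_i (1/τ̄) φ_j(p_j − p_i) x_i`. -/
def Vdyn (n : ℕ) (lam : Fin n → ℝ) (τ : ℝ) (φ : Fin n → ℝ → ℝ)
    (x p : Fin n → ℝ) (i : Fin n) : ℝ :=
  (∑ j ∈ Finset.univ.erase i, lam j * (1 / τ) * φ i (p i - p j) * x j)
    - ∑ j ∈ Finset.univ.erase i, lam i * (1 / τ) * φ j (p j - p i) * x i

/-- `ψ(s) = ∫_0^s φ(r) dr`. -/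
def psiF (φ : ℝ → ℝ) (s : ℝ) : ℝ := ∫ r in (0:ℝ)..s, φ r

/-- `γ_i(p) = Σ_k ψ_k(p_k − p_i)`. -/
def gammaF (n : ℕ) (φ : Fin n → ℝ → ℝ) (i : Fin n) (p : Fin n → ℝ) : ℝ :=
  ∑ k, psiF (φ k) (p k - p i)

/-- Worst-case revision rate ratio `λ_R = max { λ_i / λ_j }`. -/
def lamR (n : ℕ) (lam : Fin n → ℝ) : ℝ :=
  ⨆ ij : Fin n × Fin n, lam ij.1 / lam ij.2

/-- The set of values `γ_k(p) Σ_i φ_i(p_i − p_k) / Σ_i φ_i(p_i − p_k) γ_i(p)`,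
over `p` with nonvanishing denominator. -/
def thresholdSet (n : ℕ) (φ : Fin n → ℝ → ℝ) (k : Fin n) : Set ℝ :=
  {c | ∃ p : Fin n → ℝ,
    (∑ i, φ i (p i - p k) * gammaF n φ i p) ≠ 0 ∧
    c = (gammaF n φ k p * ∑ i, φ i (p i - p k)) /
        (∑ i, φ i (p i - p k) * gammaF n φ i p)}

/-- The threshold `λ̄_φ(n)`. -/
def lamBar (n : ℕ) (φ : Fin n → ℝ → ℝ) : ℝ :=
  ⨅ k : Fin n, sInf (thresholdSet n φ k)

/-- The δ-storage function `S(x,p) = (1/τ̄) Σ_i λ_i x_i γ_i(p)`. -/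
def Sfun (n : ℕ) (lam : Fin n → ℝ) (τ : ℝ) (φ : Fin n → ℝ → ℝ)
    (x p : Fin n → ℝ) : ℝ :=
  (1 / τ) * ∑ i, lam i * x i * gammaF n φ i p

/-- The dissipation rate `𝔖(x,p) = −(1/τ̄) Σ_i λ_i V_i(x,p) γ_i(p)`. -/
def SigFun (n : ℕ) (lam : Fin n → ℝ) (τ : ℝ) (φ : Fin n → ℝ → ℝ)
    (x p : Fin n → ℝ) : ℝ :=
  -((1 / τ) * ∑ i, lam i * Vdyn n lam τ φ x p i * gammaF n φ i p)

lemma psi_nonpos {f : ℝ → ℝ} (hf : SignPreserving f) {s : ℝ} (hs : s ≤ 0) : psiF f s = 0 := by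
  unfold psiF
  rw [intervalIntegral.integral_congr (g := fun _ => (0:ℝ))]
  · simp
  · intro x hx
    rw [Set.uIcc_of_ge hs] at hx
    exact hf.2 x hx.2

lemma psi_pos {f : ℝ → ℝ} (hf : SignPreserving f) (hc : Continuous f) {s : ℝ} (hs : 0 < s) :
    0 < psiF f s := by
  unfold psiF
  apply intervalIntegral.intervalIntegral_pos_of_pos_on (hc.intervalIntegrable _ _) _ hs
  intro x hx
  exact hf.1 x hx.1

lemma psi_nonneg {f : ℝ → ℝ} (hf : SignPreserving f) (hc : Continuous f) (s : ℝ) :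
    0 ≤ psiF f s := by
  rcases le_or_gt s 0 with h | h
  · rw [psi_nonpos hf h]
  · exact (psi_pos hf hc h).le

lemma psi_deriv {f : ℝ → ℝ} (hc : Continuous f) (s : ℝ) :
    HasDerivAt (psiF f) (f s) s :=
  intervalIntegral.integral_hasDerivAt_right (hc.intervalIntegrable _ _)
    (hc.stronglyMeasurableAtFilter _ _) hc.continuousAt

lemma sp_nonneg {f : ℝ → ℝ} (hf : SignPreserving f) (s : ℝ) : 0 ≤ f s := by
  rcases le_or_gt s 0 with h | h
  · rw [hf.2 s h]
  · exact (hf.1 s h).le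

section onepop

variable {n : ℕ} {lam : Fin n → ℝ} {τ : ℝ} {φ : Fin n → ℝ → ℝ}

lemma gamma_nonneg (hφ : ∀ j, SignPreserving (φ j)) (hc : ∀ j, Continuous (φ j))
    (i : Fin n) (p : Fin n → ℝ) : 0 ≤ gammaF n φ i p :=
  Finset.sum_nonneg fun k _ => psi_nonneg (hφ k) (hc k) _

lemma gamma_pos (hφ : ∀ j, SignPreserving (φ j)) (hc : ∀ j, Continuous (φ j))
    {i k : Fin n} {p : Fin n → ℝ} (h : p i < p k) : 0 < gammaF n φ i p :=
  Finset.sum_pos' (fun k _ => psi_nonneg (hφ k) (hc k) _)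
    ⟨k, Finset.mem_univ _, psi_pos (hφ k) (hc k) (by linarith)⟩

lemma gamma_zero (hφ : ∀ j, SignPreserving (φ j))
    {i : Fin n} {p : Fin n → ℝ} (h : ∀ k, p k ≤ p i) : gammaF n φ i p = 0 :=
  Finset.sum_eq_zero fun k _ => psi_nonpos (hφ k) (by linarith [h k])

lemma V_eq (hφ : ∀ j, SignPreserving (φ j)) (x p : Fin n → ℝ) (i : Fin n) :
    Vdyn n lam τ φ x p i = (∑ j, lam j * (1 / τ) * φ i (p i - p j) * x j)
    - ∑ j, lam i * (1 / τ) * φ j (p j - p i) * x i := by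
  unfold Vdyn
  have h0 : φ i (p i - p i) = 0 := (hφ i).2 _ (by simp)
  rw [Finset.sum_erase _ (by rw [h0]; ring), Finset.sum_erase _ (by rw [h0]; ring)]

lemma V_pair (hφ : ∀ j, SignPreserving (φ j)) (x p q : Fin n → ℝ) :
    ∑ k, Vdyn n lam τ φ x p k * q k
      = (1 / τ) * ∑ i, lam i * x i * ∑ k, φ k (p k - p i) * (q k - q i) := by
  simp only [V_eq hφ, sub_mul, Finset.sum_sub_distrib, Finset.sum_mul, Finset.mul_sum, mul_sub]
  congr 1
  · rw [Finset.sum_comm]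
    refine Finset.sum_congr rfl fun i _ => Finset.sum_congr rfl fun k _ => by ring
  · refine Finset.sum_congr rfl fun i _ => Finset.sum_congr rfl fun k _ => by ring

/-- bracket -/
def Br (n : ℕ) (lam : Fin n → ℝ) (φ : Fin n → ℝ → ℝ) (p : Fin n → ℝ) (i : Fin n) : ℝ :=
  ∑ k, φ k (p k - p i) * (lam i * gammaF n φ i p - lam k * gammaF n φ k p)

lemma Br_zero (hφ : ∀ j, SignPreserving (φ j)) {p : Fin n → ℝ} {i : Fin n}
    (h : ∀ k, p k ≤ p i) : Br n lam φ p i = 0 :=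
  Finset.sum_eq_zero fun k _ => by rw [(hφ k).2 _ (by linarith [h k])]; ring

lemma Br_pos (hlam : ∀ i, 0 < lam i) (hφ : ∀ j, SignPreserving (φ j))
    (hc : ∀ j, Continuous (φ j))
    (hcond : n = 2 ∨ (3 ≤ n ∧ lamR n lam < lamBar n φ)) {p : Fin n → ℝ} {i k : Fin n}
    (h : p i < p k) : 0 < Br n lam φ p i := by
  have hγ := gamma_pos (φ := φ) hφ hc h
  have hs : 0 < ∑ k, φ k (p k - p i) :=
    Finset.sum_pos' (fun k _ => sp_nonneg (hφ k) _)
      ⟨k, Finset.mem_univ _, (hφ k).1 _ (by linarith)⟩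
  have hB : Br n lam φ p i = lam i * (gammaF n φ i p * ∑ k, φ k (p k - p i))
      - ∑ k, φ k (p k - p i) * (lam k * gammaF n φ k p) := by
    unfold Br
    simp only [mul_sub, Finset.sum_sub_distrib]
    congr 1
    rw [Finset.mul_sum, Finset.mul_sum]
    exact Finset.sum_congr rfl fun k _ => by ring
  have hterm : ∀ k, 0 ≤ φ k (p k - p i) * gammaF n φ k p := fun k =>
    mul_nonneg (sp_nonneg (hφ k) _) (gamma_nonneg hφ hc k p)
  by_cases hD : (∑ k, φ k (p k - p i) * gammaF n φ k p) = 0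
  · have h0 := (Finset.sum_eq_zero_iff_of_nonneg (fun k _ => hterm k)).1 hD
    have : ∑ k, φ k (p k - p i) * (lam k * gammaF n φ k p) = 0 :=
      Finset.sum_eq_zero fun k hk => by
        have := h0 k hk
        calc _ = lam k * (φ k (p k - p i) * gammaF n φ k p) := by ring
          _ = 0 := by rw [this]; ring
    rw [hB, this, sub_zero]
    exact mul_pos (hlam i) (mul_pos hγ hs)
  · have hDpos : 0 < ∑ k, φ k (p k - p i) * gammaF n φ k p :=
      lt_of_le_of_ne (Finset.sum_nonneg fun k _ => hterm k) (Ne.symm hD)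
    rcases hcond with h2 | ⟨_, hlt⟩
    · exfalso
      apply hD
      apply Finset.sum_eq_zero
      intro j _
      rcases le_or_gt (p j) (p i) with hj | hj
      · rw [(hφ j).2 _ (by linarith)]; ring
      · rw [gamma_zero hφ (i := j), mul_zero]
        intro l
        subst h2
        have : ∀ a b c : Fin 2, a ≠ c → b = c ∨ b = a := by decide
        have hne : i ≠ j := by rintro rfl; exact lt_irrefl _ hj
        rcases this i l j hne with rfl | rfl
        · exact le_rfl
        · exact hj.le
    · have hbd : BddBelow (thresholdSet n φ i) := by
        refine ⟨0, ?_⟩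
        rintro c ⟨p', _, rfl⟩
        apply div_nonneg
        · exact mul_nonneg (gamma_nonneg hφ hc _ _) (Finset.sum_nonneg fun k _ => sp_nonneg (hφ k) _)
        · exact Finset.sum_nonneg fun k _ => mul_nonneg (sp_nonneg (hφ k) _) (gamma_nonneg hφ hc _ _)
      have h1 : sInf (thresholdSet n φ i) ≤ _ := csInf_le hbd ⟨p, hD, rfl⟩
      have h2 : lamBar n φ ≤ sInf (thresholdSet n φ i) :=
        ciInf_le (Set.finite_range _).bddBelow i
      have h3 : ∀ k, lam k ≤ lamR n lam * lam i := by
        intro k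
        rw [← div_le_iff₀ (hlam i)]
        exact le_ciSup (f := fun ij : Fin n × Fin n => lam ij.1 / lam ij.2)
          (Set.finite_range _).bddAbove (k, i)
      have h4 := lt_of_lt_of_le hlt (h2.trans h1)
      rw [lt_div_iff₀ hDpos] at h4
      have h5 : ∑ k, φ k (p k - p i) * (lam k * gammaF n φ k p)
          ≤ lam i * (lamR n lam * ∑ k, φ k (p k - p i) * gammaF n φ k p) := by
        rw [Finset.mul_sum, Finset.mul_sum]
        apply Finset.sum_le_sum
        intro k _
        have := mul_le_mul_of_nonneg_right (h3 k) (hterm k)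
        linarith
      have h6 := mul_lt_mul_of_pos_left h4 (hlam i)
      rw [hB]
      linarith

lemma Br_nonneg (hlam : ∀ i, 0 < lam i) (hφ : ∀ j, SignPreserving (φ j))
    (hc : ∀ j, Continuous (φ j))
    (hcond : n = 2 ∨ (3 ≤ n ∧ lamR n lam < lamBar n φ)) (p : Fin n → ℝ) (i : Fin n) :
    0 ≤ Br n lam φ p i := by
  by_cases h : ∀ k, p k ≤ p i
  · rw [Br_zero hφ h]
  · push Not at h
    obtain ⟨k, hk⟩ := h
    exact (Br_pos hlam hφ hc hcond hk).le

lemma Sig_eq (hφ : ∀ j, SignPreserving (φ j)) (x p : Fin n → ℝ) :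
    SigFun n lam τ φ x p = (1 / τ) * ((1 / τ) * ∑ i, lam i * x i * Br n lam φ p i) := by
  have := V_pair (lam := lam) (τ := τ) hφ x p (fun i => lam i * gammaF n φ i p)
  unfold SigFun
  have e : ∑ i, lam i * Vdyn n lam τ φ x p i * gammaF n φ i p
      = ∑ k, Vdyn n lam τ φ x p k * (lam k * gammaF n φ k p) :=
    Finset.sum_congr rfl fun i _ => by ring
  rw [e, this, ← mul_neg, ← mul_neg, ← Finset.sum_neg_distrib]
  congr 2
  refine Finset.sum_congr rfl fun i _ => ?_
  rw [← mul_neg, ← Finset.sum_neg_distrib]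
  congr 1
  exact Finset.sum_congr rfl fun k _ => by ring

/-- best response support condition -/
def BR (x p : Fin n → ℝ) : Prop := ∀ i, x i = 0 ∨ ∀ k, p k ≤ p i

lemma S_nonneg (hlam : ∀ i, 0 < lam i) (hτ : 0 < τ) (hφ : ∀ j, SignPreserving (φ j))
    (hc : ∀ j, Continuous (φ j)) {x : Fin n → ℝ} (hx : ∀ i, 0 ≤ x i) (p : Fin n → ℝ) :
    0 ≤ Sfun n lam τ φ x p := by
  refine mul_nonneg (by positivity) (Finset.sum_nonneg fun i _ => ?_)
  exact mul_nonneg (mul_nonneg (hlam i).le (hx i)) (gamma_nonneg hφ hc _ _)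

lemma S_zero_iff (hlam : ∀ i, 0 < lam i) (hτ : 0 < τ) (hφ : ∀ j, SignPreserving (φ j))
    (hc : ∀ j, Continuous (φ j)) {x : Fin n → ℝ} (hx : ∀ i, 0 ≤ x i) (p : Fin n → ℝ) :
    Sfun n lam τ φ x p = 0 ↔ BR x p := by
  have h1 : (1 / τ) ≠ 0 := by positivity
  unfold Sfun
  rw [mul_eq_zero, or_iff_right h1, Finset.sum_eq_zero_iff_of_nonneg
    (fun i _ => mul_nonneg (mul_nonneg (hlam i).le (hx i)) (gamma_nonneg hφ hc _ _))]
  constructor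
  · intro h i
    by_contra hcon
    push Not at hcon
    obtain ⟨h1, k, hk⟩ := hcon
    have := h i (Finset.mem_univ _)
    have h2 := gamma_pos (φ := φ) hφ hc hk
    have h3 := hlam i
    simp [h1, h2.ne', h3.ne'] at this
  · intro h i _
    rcases h i with h | h
    · rw [h]; ring
    · rw [gamma_zero hφ h]; ring

lemma Sig_nonneg (hlam : ∀ i, 0 < lam i) (hτ : 0 < τ) (hφ : ∀ j, SignPreserving (φ j))
    (hc : ∀ j, Continuous (φ j))
    (hcond : n = 2 ∨ (3 ≤ n ∧ lamR n lam < lamBar n φ))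
    {x : Fin n → ℝ} (hx : ∀ i, 0 ≤ x i) (p : Fin n → ℝ) :
    0 ≤ SigFun n lam τ φ x p := by
  rw [Sig_eq hφ]
  refine mul_nonneg (by positivity) (mul_nonneg (by positivity) (Finset.sum_nonneg fun i _ => ?_))
  exact mul_nonneg (mul_nonneg (hlam i).le (hx i)) (Br_nonneg hlam hφ hc hcond _ _)

lemma Sig_zero (hlam : ∀ i, 0 < lam i) (hτ : 0 < τ) (hφ : ∀ j, SignPreserving (φ j))
    (hc : ∀ j, Continuous (φ j))
    (hcond : n = 2 ∨ (3 ≤ n ∧ lamR n lam < lamBar n φ))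
    {x : Fin n → ℝ} (hx : ∀ i, 0 ≤ x i) (p : Fin n → ℝ)
    (h : SigFun n lam τ φ x p = 0) : BR x p := by
  have h1 : (1 / τ) ≠ 0 := by positivity
  rw [Sig_eq hφ, mul_eq_zero, or_iff_right h1, mul_eq_zero, or_iff_right h1,
    Finset.sum_eq_zero_iff_of_nonneg
    (fun i _ => mul_nonneg (mul_nonneg (hlam i).le (hx i)) (Br_nonneg hlam hφ hc hcond _ _))] at h
  intro i
  by_contra hcon
  push Not at hcon
  obtain ⟨h1, k, hk⟩ := hcon
  have := h i (Finset.mem_univ _)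
  have h2 := Br_pos hlam hφ hc hcond hk
  have h3 := hlam i
  simp [h1, h2.ne', h3.ne'] at this

lemma gamma_cont (hc : ∀ j, Continuous (φ j)) (i : Fin n) : Continuous (gammaF n φ i) := by
  unfold gammaF
  have : ∀ k, Continuous (psiF (φ k)) := fun k =>
    continuous_iff_continuousAt.2 fun s => (psi_deriv (hc k) s).continuousAt
  refine continuous_finsetSum _ fun k _ => (this k).comp (by fun_prop)

lemma S_cont {α : Type*} [TopologicalSpace α] (hc : ∀ j, Continuous (φ j))
    {x p : α → Fin n → ℝ} (hx : Continuous x) (hp : Continuous p) :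
    Continuous fun a => Sfun n lam τ φ (x a) (p a) := by
  unfold Sfun
  have : ∀ i, Continuous fun a => gammaF n φ i (p a) := fun i => (gamma_cont hc i).comp hp
  fun_prop

lemma Sig_cont {α : Type*} [TopologicalSpace α] (hc : ∀ j, Continuous (φ j))
    {x p : α → Fin n → ℝ} (hx : Continuous x) (hp : Continuous p) :
    Continuous fun a => SigFun n lam τ φ (x a) (p a) := by
  unfold SigFun Vdyn
  have : ∀ i, Continuous fun a => gammaF n φ i (p a) := fun i => (gamma_cont hc i).comp hp
  fun_prop

lemma S_deriv (hφ : ∀ j, SignPreserving (φ j)) (hc : ∀ j, Continuous (φ j))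
    {x p : ℝ → Fin n → ℝ} {q : Fin n → ℝ} {t : ℝ}
    (hx : ∀ i, HasDerivAt (fun s => x s i) (Vdyn n lam τ φ (x t) (p t) i) t)
    (hp : ∀ i, HasDerivAt (fun s => p s i) (q i) t) :
    HasDerivAt (fun s => Sfun n lam τ φ (x s) (p s))
      (∑ i, q i * Vdyn n lam τ φ (x t) (p t) i - SigFun n lam τ φ (x t) (p t)) t := by
  have hg : ∀ i, HasDerivAt (fun s => gammaF n φ i (p s))
      (∑ k, φ k (p t k - p t i) * (q k - q i)) t := fun i =>
    HasDerivAt.fun_sum fun k _ =>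
      HasDerivAt.comp (h₂ := psiF (φ k)) (h := fun s => p s k - p s i) t
        (psi_deriv (hc k) (p t k - p t i)) ((hp k).sub (hp i))
  have hS := (HasDerivAt.fun_sum (u := Finset.univ) fun i _ =>
    (((hx i).const_mul (lam i)).mul (hg i))).const_mul (1 / τ)
  refine hS.congr_deriv ?_
  have e : ∑ i, q i * Vdyn n lam τ φ (x t) (p t) i = ∑ i, Vdyn n lam τ φ (x t) (p t) i * q i :=
    Finset.sum_congr rfl fun i _ => by ring
  rw [e, V_pair hφ, Finset.sum_add_distrib]
  unfold SigFun
  ring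

lemma negsq_deriv (s : ℝ) : HasDerivAt (fun s : ℝ => (min s 0) ^ 2) (2 * min s 0) s := by
  rcases lt_trichotomy s 0 with h | h | h
  · have h1 : HasDerivAt (fun s : ℝ => s ^ 2) (2 * min s 0) s := by
      rw [min_eq_left h.le]; simpa using hasDerivAt_pow 2 s
    refine h1.congr_of_eventuallyEq ?_
    filter_upwards [Iio_mem_nhds h] with u hu
    rw [min_eq_left (le_of_lt hu)]
  · subst h
    rw [hasDerivAt_iff_isLittleO]
    have h2 : (fun x : ℝ => x ^ 2) =o[nhds 0] fun x => x := by
      simpa using (Asymptotics.isLittleO_pow_id (𝕜 := ℝ) (n := 2) (by norm_num))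
    simp only [min_self, sub_zero, mul_zero, smul_zero]
    norm_num
    refine Asymptotics.IsBigO.trans_isLittleO (Asymptotics.IsBigO.of_bound 1 ?_) h2
    refine Filter.Eventually.of_forall fun x => ?_
    simp only [norm_pow, one_mul]
    gcongr
    rcases le_total x 0 with h | h <;> simp [h]
  · have h1 : HasDerivAt (fun _ : ℝ => (0:ℝ)) (2 * min s 0) s := by
      rw [min_eq_right h.le]; simpa using hasDerivAt_const s (0:ℝ)
    refine h1.congr_of_eventuallyEq ?_
    filter_upwards [Ioi_mem_nhds h] with u hu
    rw [min_eq_right (le_of_lt hu)]; norm_num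

lemma invariance (hlam : ∀ i, 0 < lam i) (hτ : 0 < τ)
    (hφ : ∀ j, SignPreserving (φ j)) (hc : ∀ j, Continuous (φ j))
    {x p : ℝ → Fin n → ℝ}
    (hx : ∀ t, 0 ≤ t → ∀ i, HasDerivAt (fun s => x s i) (Vdyn n lam τ φ (x t) (p t) i) t)
    (hp : ∀ i, ContinuousOn (fun s => p s i) (Set.Ici 0))
    (h0 : x 0 ∈ simplex n) {T : ℝ} (hT : 0 ≤ T) : x T ∈ simplex n := by
  have hzero : ∀ (f : ℝ → ℝ), (∀ t, 0 ≤ t → t ≤ T → ∃ f', HasDerivAt f f' t ∧ f' ≤ 0) →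
      f T ≤ f 0 := by
    intro f hf
    have hanti : AntitoneOn f (Set.Icc 0 T) := by
      apply antitoneOn_of_deriv_nonpos (convex_Icc 0 T)
      · intro t ht
        obtain ⟨f', h, _⟩ := hf t ht.1 ht.2
        exact h.continuousAt.continuousWithinAt
      · intro t ht
        rw [interior_Icc] at ht
        obtain ⟨f', h, _⟩ := hf t ht.1.le ht.2.le
        exact h.differentiableAt.differentiableWithinAt
      · intro t ht
        rw [interior_Icc] at ht
        obtain ⟨f', h, h'⟩ := hf t ht.1.le ht.2.le
        rw [h.deriv]; exact h'
    exact hanti ⟨le_rfl, hT⟩ ⟨hT, le_rfl⟩ hT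
  have hsumV : ∀ t, ∑ i, Vdyn n lam τ φ (x t) (p t) i = 0 := by
    intro t
    have := V_pair (lam := lam) (τ := τ) hφ (x t) (p t) (fun _ => 1)
    simpa using this
  have hsum : ∀ t, 0 ≤ t → HasDerivAt (fun s => ∑ i, x s i) 0 t := by
    intro t ht
    rw [← hsumV t]
    exact HasDerivAt.fun_sum fun i _ => hx t ht i
  have hs1 := hzero (fun s => ∑ i, x s i) fun t h _ => ⟨0, hsum t h, le_rfl⟩
  have hs2 := hzero (fun s => -∑ i, x s i) fun t h _ => ⟨-0, (hsum t h).neg, by simp⟩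
  have hsumT : ∑ i, x T i = 1 := by
    have := h0.2
    linarith
  refine ⟨?_, hsumT⟩
  -- bound
  let a : Fin n → Fin n → ℝ → ℝ := fun i j t => lam j * (1 / τ) * φ i (p t i - p t j)
  have ha0 : ∀ i j t, 0 ≤ a i j t := fun i j t =>
    mul_nonneg (mul_nonneg (hlam j).le (by positivity)) (sp_nonneg (hφ i) _)
  have hac : ∀ i j, ContinuousOn (a i j) (Set.Icc 0 T) := by
    intro i j
    have h1 := (hp i).mono (fun t (ht : t ∈ Set.Icc 0 T) => ht.1)
    have h2 := (hp j).mono (fun t (ht : t ∈ Set.Icc 0 T) => ht.1)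
    exact continuousOn_const.mul ((hc i).comp_continuousOn (h1.sub h2))
  have hM : ∃ M : ℝ, 0 ≤ M ∧ ∀ t ∈ Set.Icc 0 T, ∀ i j, a i j t ≤ M := by
    have hcs : ContinuousOn (fun t => ∑ i, ∑ j, a i j t) (Set.Icc 0 T) :=
      continuousOn_finsetSum _ fun i _ => continuousOn_finsetSum _ fun j _ => hac i j
    obtain ⟨M, hM⟩ := (isCompact_Icc (a := (0:ℝ)) (b := T)).bddAbove_image hcs
    have key : ∀ t ∈ Set.Icc 0 T, ∑ i, ∑ j, a i j t ≤ M := fun t ht =>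
      hM ⟨t, ht, rfl⟩
    refine ⟨M, ?_, fun t ht i j => ?_⟩
    · refine le_trans ?_ (key 0 ⟨le_rfl, hT⟩)
      exact Finset.sum_nonneg fun i _ => Finset.sum_nonneg fun j _ => ha0 i j 0
    · refine le_trans ?_ (key t ht)
      refine le_trans ?_ (Finset.single_le_sum (f := fun i => ∑ j, a i j t)
        (fun i _ => Finset.sum_nonneg fun j _ => ha0 i j t) (Finset.mem_univ i))
      exact Finset.single_le_sum (f := fun j => a i j t) (fun j _ => ha0 i j t) (Finset.mem_univ j)
  obtain ⟨M, hM0, hM⟩ := hM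
  let f : ℝ → ℝ := fun t => ∑ i, (min (x t i) 0) ^ 2
  have hfd : ∀ t, 0 ≤ t → HasDerivAt f
      (∑ i, 2 * min (x t i) 0 * Vdyn n lam τ φ (x t) (p t) i) t := fun t ht =>
    HasDerivAt.fun_sum fun i _ => HasDerivAt.comp (h₂ := fun s : ℝ => (min s 0) ^ 2)
      (h := fun s => x s i) t (negsq_deriv (x t i)) (hx t ht i)
  let C : ℝ := 2 * M * n
  have hfb : ∀ t, 0 ≤ t → t ≤ T →
      ∑ i, 2 * min (x t i) 0 * Vdyn n lam τ φ (x t) (p t) i ≤ C * f t := by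
    intro t ht htT
    have h1 : ∀ i, 2 * min (x t i) 0 * Vdyn n lam τ φ (x t) (p t) i
        ≤ ∑ j, M * ((min (x t i) 0) ^ 2 + (min (x t j) 0) ^ 2) := by
      intro i
      rw [V_eq hφ, mul_sub, Finset.mul_sum, Finset.mul_sum, ← Finset.sum_sub_distrib]
      apply Finset.sum_le_sum
      intro j _
      have e1 := ha0 i j t
      have e2 := hM t ⟨ht, htT⟩ i j
      have e3 := ha0 j i t
      change 2 * min (x t i) 0 * (a i j t * x t j) - 2 * min (x t i) 0 * (a j i t * x t i) ≤ _
      have m1 : min (x t i) 0 ≤ 0 := min_le_right _ _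
      have m2 : min (x t j) 0 ≤ x t j := min_le_left _ _
      have m3 : min (x t i) 0 * x t i = (min (x t i) 0) ^ 2 := by
        rcases le_total (x t i) 0 with h | h <;> simp [h, sq]
      have s1 : 2 * min (x t i) 0 * (a j i t * x t i) = 2 * a j i t * (min (x t i) 0) ^ 2 := by
        rw [← m3]; ring
      have s2 : 0 ≤ 2 * a j i t * (min (x t i) 0) ^ 2 := by positivity
      have s3 : min (x t i) 0 * x t j ≤ min (x t i) 0 * min (x t j) 0 :=
        mul_le_mul_of_nonpos_left m2 m1
      have s4 : 2 * (min (x t i) 0 * x t j) ≤ (min (x t i) 0) ^ 2 + (min (x t j) 0) ^ 2 := by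
        nlinarith [sq_nonneg (min (x t i) 0 - min (x t j) 0)]
      have s5 := mul_le_mul_of_nonneg_left s4 e1
      have s6 := mul_le_mul_of_nonneg_right e2
        (add_nonneg (sq_nonneg (min (x t i) 0)) (sq_nonneg (min (x t j) 0)))
      rw [s1]
      linarith
    refine (Finset.sum_le_sum fun i _ => h1 i).trans (le_of_eq ?_)
    simp only [← Finset.mul_sum, Finset.sum_add_distrib, Finset.sum_const, Finset.card_univ,
      Fintype.card_fin, nsmul_eq_mul, C, f]
    ring
  have hfin := hzero (fun t => Real.exp (-(C * t)) * f t) (by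
    intro t ht htT
    have he : HasDerivAt (fun t => Real.exp (-(C * t))) (Real.exp (-(C * t)) * (-(C * 1))) t :=
      (((hasDerivAt_id t).const_mul C).neg).exp
    refine ⟨_, he.mul (hfd t ht), ?_⟩
    have := mul_le_mul_of_nonneg_left (hfb t ht htT) (Real.exp_pos (-(C * t))).le
    linarith)
  have hf0 : f 0 = 0 := Finset.sum_eq_zero fun i _ => by
    rw [min_eq_right (h0.1 i)]; norm_num
  simp only [hf0, mul_zero] at hfin
  have hfT : f T ≤ 0 := by
    by_contra hcon
    push Not at hcon
    have := mul_pos (Real.exp_pos (-(C * T))) hcon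
    linarith
  intro i
  by_contra hcon
  push Not at hcon
  have hle : (min (x T i) 0) ^ 2 ≤ f T :=
    Finset.single_le_sum (f := fun i => (min (x T i) 0) ^ 2) (fun i _ => sq_nonneg _)
      (Finset.mem_univ i)
  rw [min_eq_left hcon.le] at hle
  nlinarith

end onepop

lemma lyap {E : Type*} [MetricSpace E] {X N : Set E} (hX : IsCompact X)
    (hN : N ⊆ X) {L D : E → ℝ} (hL : Continuous L) (hD : Continuous D)
    (hL0 : ∀ x ∈ X, 0 ≤ L x) (hLz : ∀ x ∈ X, L x = 0 ↔ x ∈ N)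
    (hD0 : ∀ x ∈ X, 0 ≤ D x) (hDz : ∀ x ∈ X, D x = 0 → x ∈ N)
    (Sol : (ℝ → E) → Prop)
    (hinv : ∀ z, Sol z → ∀ t, 0 ≤ t → z t ∈ X)
    (hder : ∀ z, Sol z → ∀ t, 0 ≤ t → ∃ l, HasDerivAt (fun s => L (z s)) l t ∧ l ≤ - D (z t)) :
    (∀ ε > 0, ∃ δ > 0, ∀ z, Sol z → Metric.infDist (z 0) N < δ →
      ∀ t ∈ Set.Ici (0:ℝ), Metric.infDist (z t) N < ε) ∧
    (∀ z, Sol z →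
      Filter.Tendsto (fun t => Metric.infDist (z t) N) Filter.atTop (nhds 0)) := by
  rcases N.eq_empty_or_nonempty with rfl | hne
  · simp only [Metric.infDist_empty]
    exact ⟨fun ε hε => ⟨1, one_pos, fun _ _ _ _ _ => hε⟩, fun _ _ => tendsto_const_nhds⟩
  have hm : ∀ ε > 0, ∃ m > 0, ∀ x ∈ X, L x < m → Metric.infDist x N < ε := by
    intro ε hε
    have hK : IsCompact (X ∩ {x | ε ≤ Metric.infDist x N}) :=
      hX.inter_right (isClosed_le continuous_const (Metric.continuous_infDist_pt N))
    rcases (X ∩ {x | ε ≤ Metric.infDist x N}).eq_empty_or_nonempty with he | hKne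
    · refine ⟨1, one_pos, fun x hx _ => ?_⟩
      by_contra hcon
      push Not at hcon
      have : x ∈ X ∩ {x | ε ≤ Metric.infDist x N} := ⟨hx, hcon⟩
      rw [he] at this
      exact this
    · obtain ⟨y, hy, hmin⟩ := hK.exists_isMinOn hKne hL.continuousOn
      refine ⟨L y, ?_, fun x hx hlt => ?_⟩
      · refine lt_of_le_of_ne (hL0 y hy.1) fun h => ?_
        have hyN := (hLz y hy.1).1 h.symm
        have h2 := hy.2
        simp only [Set.mem_setOf_eq, Metric.infDist_zero_of_mem hyN] at h2
        linarith
      · by_contra hcon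
        push Not at hcon
        have h3 : L y ≤ L x := hmin ⟨hx, hcon⟩
        linarith
  have hdec : ∀ z, Sol z → ∀ c, (∀ t, 0 ≤ t → c ≤ D (z t)) →
      AntitoneOn (fun t => L (z t) + c * t) (Set.Ici 0) := by
    intro z hz c hcD
    have hd : ∀ t, 0 ≤ t → ∃ l, HasDerivAt (fun t => L (z t) + c * t) l t ∧ l ≤ 0 := by
      intro t ht
      obtain ⟨l, h1, h2⟩ := hder z hz t ht
      exact ⟨_, h1.add ((hasDerivAt_id t).const_mul c), by linarith [hcD t ht]⟩
    apply antitoneOn_of_deriv_nonpos (convex_Ici 0)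
    · intro t ht
      obtain ⟨l, h, _⟩ := hd t ht
      exact h.continuousAt.continuousWithinAt
    · intro t ht
      rw [interior_Ici] at ht
      obtain ⟨l, h, _⟩ := hd t (le_of_lt ht)
      exact h.differentiableAt.differentiableWithinAt
    · intro t ht
      rw [interior_Ici] at ht
      obtain ⟨l, h, h'⟩ := hd t (le_of_lt ht)
      rw [h.deriv]; exact h'
  have hanti : ∀ z, Sol z → ∀ s t, 0 ≤ s → s ≤ t → L (z t) ≤ L (z s) := by
    intro z hz s t hs hst
    have := hdec z hz 0 (fun t ht => hD0 _ (hinv z hz t ht)) hs (hs.trans hst : (0:ℝ) ≤ t) hst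
    simpa using this
  constructor
  · intro ε hε
    obtain ⟨m, hm0, hmε⟩ := hm ε hε
    have huc := hX.uniformContinuousOn_of_continuous hL.continuousOn
    rw [Metric.uniformContinuousOn_iff] at huc
    obtain ⟨δ, hδ, hδm⟩ := huc m hm0
    refine ⟨δ, hδ, fun z hz hd t ht => ?_⟩
    apply hmε _ (hinv z hz t ht)
    refine lt_of_le_of_lt (hanti z hz 0 t le_rfl ht) ?_
    obtain ⟨y, hy, hyd⟩ := (Metric.infDist_lt_iff hne).1 hd
    have h1 := hδm _ (hinv z hz 0 le_rfl) y (hN hy) hyd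
    rw [(hLz y (hN hy)).2 hy, Real.dist_eq, sub_zero] at h1
    exact lt_of_abs_lt h1
  · intro z hz
    rw [Metric.tendsto_atTop]
    intro ε hε
    obtain ⟨m, hm0, hmε⟩ := hm ε hε
    have hex : ∃ t0, 0 ≤ t0 ∧ L (z t0) < m := by
      by_contra hcon
      push Not at hcon
      have hK : IsCompact (X ∩ {x | m ≤ L x}) :=
        hX.inter_right (isClosed_le continuous_const hL)
      obtain ⟨y, hy, hmin⟩ := hK.exists_isMinOn ⟨z 0, hinv z hz 0 le_rfl, hcon 0 le_rfl⟩
        hD.continuousOn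
      have hDy : 0 < D y := by
        refine lt_of_le_of_ne (hD0 y hy.1) fun h => ?_
        have h1 := (hLz y hy.1).2 (hDz y hy.1 h.symm)
        have h2 : m ≤ L y := hy.2
        linarith
      have hmono := hdec z hz (D y) (fun t ht => hmin ⟨hinv z hz t ht, hcon t ht⟩)
      have hz0 := hL0 _ (hinv z hz 0 le_rfl)
      have ht1 : 0 ≤ (L (z 0)) / D y := by positivity
      have h3 := hmono (le_refl (0:ℝ)) (ht1 : (0:ℝ) ≤ _) ht1
      have h4 := hcon _ ht1
      simp only [mul_zero, add_zero] at h3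
      rw [mul_div_cancel₀ _ hDy.ne'] at h3
      linarith
    obtain ⟨t0, ht0, hlt⟩ := hex
    refine ⟨t0, fun t ht => ?_⟩
    rw [Real.dist_eq, sub_zero, abs_of_nonneg Metric.infDist_nonneg]
    exact hmε _ (hinv z hz t (ht0.trans ht)) (lt_of_le_of_lt (hanti z hz t0 t ht0 ht) hlt)

/-- **Theorem 2 (GAS for memoryless weighted-contractive games).** If each
population follows an RM-PC protocol satisfying the conditions of Theorem 1 and
`F` is a continuously differentiable weighted-contractive game, then the Nash
equilibria set `NE(F)` is a globally asymptotically stable equilibria set of the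
mean closed loop `ẋ^r = V^r(x^r, F^r(x))`: solutions starting in `𝕏` remain in
`𝕏`, `NE(F)` is Lyapunov stable, and every solution converges to `NE(F)`. -/
theorem gas_memoryless_weighted_contractive
    (ρ : ℕ) (hρ : 1 ≤ ρ)
    (nn : Fin ρ → ℕ) (hnn : ∀ r, 2 ≤ nn r)
    (lam : ∀ r : Fin ρ, Fin (nn r) → ℝ) (hlam : ∀ r i, 0 < lam r i)
    (τ : Fin ρ → ℝ) (hτ : ∀ r, 0 < τ r)
    (φ : ∀ r : Fin ρ, Fin (nn r) → ℝ → ℝ)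
    (hφ : ∀ r j, SignPreserving (φ r j))
    (hLip : ∀ r j, ∃ K, LipschitzWith K (φ r j))
    (hcond : ∀ r, nn r = 2 ∨ (3 ≤ nn r ∧ lamR (nn r) (lam r) < lamBar (nn r) (φ r)))
    (F : (∀ r, Fin (nn r) → ℝ) → (∀ r, Fin (nn r) → ℝ))
    (hF : ContDiff ℝ 1 F)
    (w : Fin ρ → ℝ) (hw : ∀ r, 0 < w r)
    (hcontr : ∀ x y : ∀ r, Fin (nn r) → ℝ,
      (∀ r, x r ∈ simplex (nn r)) → (∀ r, y r ∈ simplex (nn r)) →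
      (∑ r, w r * ∑ i, (F x r i - F y r i) * (x r i - y r i)) ≤ 0)
    -- the product of the simplices
    (𝕏 : Set (∀ r, Fin (nn r) → ℝ))
    (h𝕏 : 𝕏 = {x | ∀ r, x r ∈ simplex (nn r)})
    -- the Nash equilibria set of F
    (NE : Set (∀ r, Fin (nn r) → ℝ))
    (hNE : NE = {x | x ∈ 𝕏 ∧ ∀ y ∈ 𝕏,
      (∑ r, ∑ i, y r i * F x r i) ≤ ∑ r, ∑ i, x r i * F x r i})
    -- solutions of the mean closed loop with initial condition in 𝕏
    (IsSol : (ℝ → ∀ r, Fin (nn r) → ℝ) → Prop)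
    (hIsSol : ∀ z : ℝ → ∀ r, Fin (nn r) → ℝ,
      IsSol z ↔ (z 0 ∈ 𝕏 ∧ ∀ t ∈ Set.Ici (0:ℝ),
        HasDerivAt z
          (fun r i => Vdyn (nn r) (lam r) (τ r) (φ r) (z t r) (F (z t) r) i) t)) :
    -- forward invariance of 𝕏
    (∀ z, IsSol z → ∀ t ∈ Set.Ici (0:ℝ), z t ∈ 𝕏) ∧
    -- Lyapunov stability of NE
    (∀ ε > 0, ∃ δ > 0, ∀ z, IsSol z → Metric.infDist (z 0) NE < δ →
      ∀ t ∈ Set.Ici (0:ℝ), Metric.infDist (z t) NE < ε) ∧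
    -- global attractivity of NE
    (∀ z, IsSol z →
      Filter.Tendsto (fun t => Metric.infDist (z t) NE) Filter.atTop (nhds 0)) := by
  have hc : ∀ r j, Continuous (φ r j) := fun r j => (hLip r j).elim fun K h => h.continuous
  have hFc : Continuous F := hF.continuous
  have hFr : ∀ r, Continuous fun x => F x r := fun r => (continuous_apply r).comp hFc
  have hxr : ∀ r, Continuous fun x : (∀ r, Fin (nn r) → ℝ) => x r := fun r => continuous_apply r
  have hzc : ∀ z, IsSol z → ∀ t, 0 ≤ t → ∀ r i,
      HasDerivAt (fun s => z s r i)
        (Vdyn (nn r) (lam r) (τ r) (φ r) (z t r) (F (z t) r) i) t := by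
    intro z hz t ht r i
    have h := ((hIsSol z).1 hz).2 t ht
    exact hasDerivAt_pi.1 (hasDerivAt_pi.1 h r) i
  have hinv : ∀ z, IsSol z → ∀ t ∈ Set.Ici (0:ℝ), z t ∈ 𝕏 := by
    intro z hz t ht
    have hz' := (hIsSol z).1 hz
    rw [h𝕏] at hz' ⊢
    intro r
    refine invariance (x := fun s => z s r) (p := fun s => F (z s) r) (hlam r) (hτ r) (hφ r) (hc r)
      (fun t ht i => hzc z hz t ht r i) ?_ (hz'.1 r) ht
    intro i s hs
    have h1 : ContinuousAt z s := (hz'.2 s hs).continuousAt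
    have h2 : Continuous fun x => F x r i := (continuous_apply i).comp (hFr r)
    exact (ContinuousAt.comp (g := fun x => F x r i) h2.continuousAt h1).continuousWithinAt
  refine ⟨hinv, ?_⟩
  have hNEiff : ∀ x ∈ 𝕏, x ∈ NE ↔ ∀ r, BR (x r) (F x r) := by
    intro x hx
    have hx' : ∀ r, x r ∈ simplex (nn r) := by rw [h𝕏] at hx; exact hx
    rw [hNE]
    have hk : ∀ r, ∃ k : Fin (nn r), ∀ j, F x r j ≤ F x r k := by
      intro r
      haveI : Nonempty (Fin (nn r)) := ⟨⟨0, by linarith [hnn r]⟩⟩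
      exact Finite.exists_max (F x r)
    choose k hk using hk
    have hgap : ∀ y : (∀ r, Fin (nn r) → ℝ), (∀ r, y r ∈ simplex (nn r)) → ∀ r,
        ∑ i, y r i * F x r i = F x r (k r) - ∑ i, y r i * (F x r (k r) - F x r i) := by
      intro y hy r
      simp only [mul_sub, Finset.sum_sub_distrib, ← Finset.sum_mul, (hy r).2]
      ring
    constructor
    · rintro ⟨_, h⟩ 
      have hy : ∀ r, (Pi.single (k r) 1 : Fin (nn r) → ℝ) ∈ simplex (nn r) := by
        intro r
        refine ⟨fun i => ?_, by simp⟩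
        by_cases hi : i = k r
        · subst hi; simp
        · simp [hi]
      have h1 := h (fun r => Pi.single (k r) 1) (by rw [h𝕏]; exact hy)
      have e1 : ∀ r, ∑ i, (Pi.single (k r) 1 : Fin (nn r) → ℝ) i * F x r i = F x r (k r) := by
        intro r
        simp [Pi.single_apply]
      simp only [e1, hgap x hx', Finset.sum_sub_distrib] at h1
      have hnn0 : ∀ r i, 0 ≤ x r i * (F x r (k r) - F x r i) := fun r i =>
        mul_nonneg ((hx' r).1 i) (by linarith [hk r i])
      have h2 : ∑ r, ∑ i, x r i * (F x r (k r) - F x r i) = 0 :=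
        le_antisymm (by linarith) (Finset.sum_nonneg fun r _ => Finset.sum_nonneg fun i _ => hnn0 r i)
      intro r i
      have h3 := (Finset.sum_eq_zero_iff_of_nonneg
        (fun r _ => Finset.sum_nonneg fun i _ => hnn0 r i)).1 h2 r (Finset.mem_univ _)
      have h4 := (Finset.sum_eq_zero_iff_of_nonneg (fun i _ => hnn0 r i)).1 h3 i (Finset.mem_univ _)
      rcases mul_eq_zero.1 h4 with h5 | h5
      · exact Or.inl h5
      · exact Or.inr fun j => by linarith [hk r j]
    · intro h
      refine ⟨hx, fun y hy => ?_⟩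
      rw [h𝕏] at hy
      refine Finset.sum_le_sum fun r _ => ?_
      rw [hgap y hy, hgap x hx']
      have h0 : ∑ i, x r i * (F x r (k r) - F x r i) = 0 := Finset.sum_eq_zero fun i _ => by
        rcases h r i with h1 | h1
        · rw [h1]; ring
        · rw [le_antisymm (h1 (k r)) (hk r i)]; ring
      have h1 : 0 ≤ ∑ i, y r i * (F x r (k r) - F x r i) := Finset.sum_nonneg fun i _ =>
        mul_nonneg ((hy r).1 i) (by linarith [hk r i])
      linarith
  have hXc : IsCompact 𝕏 := by
    have : 𝕏 = Set.univ.pi fun r => stdSimplex ℝ (Fin (nn r)) := by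
      rw [h𝕏]; ext x; simp [simplex, stdSimplex]
    rw [this]
    exact isCompact_univ_pi fun r => isCompact_stdSimplex ℝ (Fin (nn r))
  refine lyap (X := 𝕏) (N := NE)
    (L := fun x => ∑ r, w r * Sfun (nn r) (lam r) (τ r) (φ r) (x r) (F x r))
    (D := fun x => ∑ r, w r * SigFun (nn r) (lam r) (τ r) (φ r) (x r) (F x r))
    hXc ?_ ?_ ?_ ?_ ?_ ?_ ?_ IsSol hinv ?_
  · rw [hNE]; exact fun x hx => hx.1
  · exact continuous_finsetSum _ fun r _ => continuous_const.mul (S_cont (hc r) (hxr r) (hFr r))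
  · exact continuous_finsetSum _ fun r _ => continuous_const.mul (Sig_cont (hc r) (hxr r) (hFr r))
  · intro x hx
    rw [h𝕏] at hx
    exact Finset.sum_nonneg fun r _ => mul_nonneg (hw r).le
      (S_nonneg (hlam r) (hτ r) (hφ r) (hc r) (hx r).1 _)
  · intro x hx
    rw [hNEiff x hx]
    rw [h𝕏] at hx
    rw [Finset.sum_eq_zero_iff_of_nonneg (fun r _ => mul_nonneg (hw r).le
      (S_nonneg (hlam r) (hτ r) (hφ r) (hc r) (hx r).1 _))]
    refine ⟨fun h r => ?_, fun h r _ => ?_⟩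
    · have := h r (Finset.mem_univ _)
      rw [mul_eq_zero, or_iff_right (hw r).ne',
        S_zero_iff (hlam r) (hτ r) (hφ r) (hc r) (hx r).1] at this
      exact this
    · rw [(S_zero_iff (hlam r) (hτ r) (hφ r) (hc r) (hx r).1 _).2 (h r), mul_zero]
  · intro x hx
    rw [h𝕏] at hx
    exact Finset.sum_nonneg fun r _ => mul_nonneg (hw r).le
      (Sig_nonneg (hlam r) (hτ r) (hφ r) (hc r) (hcond r) (hx r).1 _)
  · intro x hx h
    rw [hNEiff x hx]
    rw [h𝕏] at hx
    rw [Finset.sum_eq_zero_iff_of_nonneg (fun r _ => mul_nonneg (hw r).le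
      (Sig_nonneg (hlam r) (hτ r) (hφ r) (hc r) (hcond r) (hx r).1 _))] at h
    intro r
    have := h r (Finset.mem_univ _)
    rw [mul_eq_zero, or_iff_right (hw r).ne'] at this
    exact Sig_zero (hlam r) (hτ r) (hφ r) (hc r) (hcond r) (hx r).1 _ this
  · intro z hz t ht
    have hzd := ((hIsSol z).1 hz).2 t ht
    have hFd := ((hF.differentiable (by norm_num)) (z t)).hasFDerivAt.comp_hasDerivAt t hzd
    obtain ⟨q, hq⟩ : ∃ q, HasDerivAt (F ∘ z) q t := ⟨_, hFd⟩
    have hqi : ∀ r i, HasDerivAt (fun s => F (z s) r i) (q r i) t := fun r i =>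
      hasDerivAt_pi.1 (hasDerivAt_pi.1 hq r) i
    have hvi := hzc z hz t ht
    refine ⟨_, HasDerivAt.fun_sum fun r _ => (S_deriv (x := fun s => z s r)
      (p := fun s => F (z s) r) (hφ r) (hc r) (hvi r) (hqi r)).const_mul (w r), ?_⟩
    simp only [mul_sub, Finset.sum_sub_distrib]
    have hmain : ∑ r, w r * ∑ i, q r i *
        Vdyn (nn r) (lam r) (τ r) (φ r) (z t r) (F (z t) r) i ≤ 0 := by
      have hlim : Filter.Tendsto (fun s => ∑ r, w r * ∑ i,
          slope (fun s => F (z s) r i) t s * slope (fun s => z s r i) t s)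
          (nhdsWithin t (Set.Ioi t)) (nhds (∑ r, w r * ∑ i, q r i *
            Vdyn (nn r) (lam r) (τ r) (φ r) (z t r) (F (z t) r) i)) := by
        refine tendsto_finsetSum _ fun r _ => Filter.Tendsto.const_mul _
          (tendsto_finsetSum _ fun i _ => ?_)
        have hle : nhdsWithin t (Set.Ioi t) ≤ nhdsWithin t {t}ᶜ :=
          nhdsWithin_mono _ fun s hs => ne_of_gt hs
        exact ((hasDerivAt_iff_tendsto_slope.1 (hqi r i)).mono_left hle).mul
          ((hasDerivAt_iff_tendsto_slope.1 (hvi r i)).mono_left hle)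
      refine le_of_tendsto hlim ?_
      filter_upwards [self_mem_nhdsWithin] with s hs
      have hs' : t < s := hs
      have h1 := hinv z hz t ht
      have h2 := hinv z hz s (le_trans ht hs'.le)
      rw [h𝕏] at h1 h2
      have h3 := hcontr (z s) (z t) h2 h1
      have e : ∑ r, w r * ∑ i,
          slope (fun s => F (z s) r i) t s * slope (fun s => z s r i) t s
          = ((s - t)⁻¹) ^ 2 * ∑ r, w r * ∑ i,
            (F (z s) r i - F (z t) r i) * (z s r i - z t r i) := by
        simp only [Finset.mul_sum, slope_def_field]
        refine Finset.sum_congr rfl fun r _ => Finset.sum_congr rfl fun i _ => by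
          simp only [div_eq_mul_inv]; ring
      rw [e]
      exact mul_nonpos_of_nonneg_of_nonpos (sq_nonneg _) h3
    linarith

end RMPC
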